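/- arXiv:2402.10161 — 6 statements merged into one kernel-verified Lean document; each statement's English description precedes it below -/
import Mathlib

section
/- Let α > 0 and β > 0. The Behavioral entropy H^B_{α,β} is a continuous function on the probability simplex P_M = {p ∈ ℝ^M : p_i ≥ 0, Σ_{i=1}^M p_i = 1} (with respect to the subspace topology of ℝ^M). -/
open MeasureTheory Real Filter Topology

/-- Prelec's probability weighting function: `w(p) = exp(-β(-log p)^α)` for `p ≠ 0`, `w(0) = 0`. -/
noncomputable def prelec (α β p : ℝ) : ℝ :=
  if p = 0 then 0 else Real.exp (-β * (-Real.log p) ^ α)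

/-- Behavioral entropy `H^B_{α,β}(p) = -∑ i, w(p_i) log (w(p_i))` (note `Real.log 0 = 0`,
so the convention `0 · log 0 = 0` holds automatically). -/
noncomputable def behEnt (α β : ℝ) {M : ℕ} (p : Fin M → ℝ) : ℝ :=
  -∑ i, prelec α β (p i) * Real.log (prelec α β (p i))

/-- The weighting function is continuous on all of `ℝ`: away from `0` it is a composition of
continuous functions, and `-log x → ∞` as `x → 0`. -/
theorem continuous_prelec {α β : ℝ} (hα : 0 < α) (hβ : 0 < β) : Continuous (prelec α β) := by
  have hrpow : Continuous fun t : ℝ => t ^ α := Real.continuous_rpow_const hα.le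
  refine continuous_iff_continuousAt.2 fun x => ?_
  rcases eq_or_ne x 0 with rfl | hx
  · rw [continuousAt_iff_punctured_nhds]
    have hlog : Tendsto (fun x : ℝ => -Real.log x) (𝓝[≠] 0) atTop :=
      tendsto_neg_atBot_atTop.comp Real.tendsto_log_nhdsNE_zero
    have hlim : Tendsto (fun x : ℝ => Real.exp (-β * (-Real.log x) ^ α)) (𝓝[≠] 0) (𝓝 0) :=
      Real.tendsto_exp_atBot.comp
        (((tendsto_rpow_atTop hα).comp hlog).const_mul_atTop_of_neg (neg_neg_of_pos hβ))
    rw [show prelec α β 0 = 0 from if_pos rfl]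
    refine hlim.congr' ?_
    filter_upwards [self_mem_nhdsWithin] with y hy
    exact (if_neg hy).symm
  · have hcont : ContinuousAt (fun x : ℝ => Real.exp (-β * (-Real.log x) ^ α)) x :=
      Real.continuous_exp.continuousAt.comp
        (continuousAt_const.mul (hrpow.continuousAt.comp (Real.continuousAt_log hx).neg))
    refine hcont.congr ?_
    filter_upwards [isOpen_ne.mem_nhds hx] with y hy
    exact (if_neg hy).symm

/-- Continuity: Behavioral entropy is continuous on the probability simplex. -/
theorem behEnt_continuousOn (M : ℕ) (α β : ℝ) (hα : 0 < α) (hβ : 0 < β) :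
    ContinuousOn (fun p : Fin M → ℝ => behEnt α β p)
      {p : Fin M → ℝ | (∀ i, 0 ≤ p i) ∧ ∑ i, p i = 1} := by
  refine Continuous.continuousOn ?_
  unfold behEnt
  exact (continuous_finsetSum _ fun i _ =>
    Real.continuous_mul_log.comp ((continuous_prelec hα hβ).comp (continuous_apply i))).neg
end

section
/- Let M ≥ 2 be an integer, and for α > 0 with α ≠ 1 set β_α = (log M)^{1-α}. Then as α tends to infinity, the conditioned Prelec weight satisfies: lim_{α→∞} w_{α,β_α}(p) = 1 for every fixed p ∈ (1/M, 1), and lim_{α→∞} w_{α,β_α}(p) = 0 for every fixed p ∈ (0, 1/M). -/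
open MeasureTheory Real Filter Topology

/-- The conditioned Prelec parameter `β_α = (log M)^(1-α)` ensuring the fixed point is `1/M`. -/
noncomputable def betaCond (M : ℕ) (α : ℝ) : ℝ := (Real.log M) ^ (1 - α)

/-- The conditioned Prelec weight in terms of the ratio `-log p / log M`. -/
lemma prelec_betaCond_eq {M : ℕ} (hM : 2 ≤ M) {p : ℝ} (hp₀ : 0 < p) (hp₁ : p ≤ 1) (α : ℝ) :
    prelec α (betaCond M α) p =
      Real.exp (-(Real.log M * (-Real.log p / Real.log M) ^ α)) := by
  have hL : 0 < Real.log M := Real.log_pos (by exact_mod_cast hM)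
  have hx : 0 ≤ -Real.log p := neg_nonneg.2 (Real.log_nonpos hp₀.le hp₁)
  rw [prelec, if_neg hp₀.ne', betaCond, Real.rpow_sub hL, Real.rpow_one,
    Real.div_rpow hx hL.le]
  congr 1
  ring

/-- As `α → ∞`, the conditioned Prelec weight tends to `1` on `(1/M, 1)` and to `0` on `(0, 1/M)`. -/
theorem prelec_conditioned_tendsto_atTop (M : ℕ) (hM : 2 ≤ M) :
    (∀ p : ℝ, p ∈ Set.Ioo (1 / (M : ℝ)) 1 →
      Tendsto (fun α : ℝ => prelec α (betaCond M α) p) atTop (𝓝 1)) ∧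
    (∀ p : ℝ, p ∈ Set.Ioo (0 : ℝ) (1 / (M : ℝ)) →
      Tendsto (fun α : ℝ => prelec α (betaCond M α) p) atTop (𝓝 0)) := by
  have hM₁ : (1 : ℝ) < M := by exact_mod_cast hM
  have hM₀ : (0 : ℝ) < M := one_pos.trans hM₁
  have hL : 0 < Real.log M := Real.log_pos hM₁
  have hlog : Real.log (1 / (M : ℝ)) = -Real.log M := by rw [one_div, Real.log_inv]
  refine ⟨fun p hp => ?_, fun p hp => ?_⟩
  · have hp₀ : 0 < p := (one_div_pos.2 hM₀).trans hp.1
    simp_rw [prelec_betaCond_eq hM hp₀ hp.2.le]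
    have hx : 0 < -Real.log p := neg_pos.2 (Real.log_neg hp₀ hp.2)
    have hlt := Real.log_lt_log (one_div_pos.2 hM₀) hp.1
    have hratio : -Real.log p / Real.log M < 1 := by
      rw [div_lt_one hL]
      linarith
    have hpow := tendsto_rpow_atTop_of_base_lt_one (-Real.log p / Real.log M)
      (neg_one_lt_zero.trans (div_pos hx hL)) hratio
    simpa [Function.comp_def] using
      (Real.continuous_exp.tendsto _).comp (hpow.const_mul (Real.log M)).neg
  · have hp₁ : p ≤ 1 := hp.2.le.trans ((div_le_one hM₀).2 hM₁.le)
    simp_rw [prelec_betaCond_eq hM hp.1 hp₁]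
    have hlt := Real.log_lt_log hp.1 hp.2
    have hratio : 1 < -Real.log p / Real.log M := by
      rw [one_lt_div hL]
      linarith
    have hpow := tendsto_rpow_atTop_of_base_gt_one (-Real.log p / Real.log M) hratio
    exact Real.tendsto_exp_neg_atTop_nhds_zero.comp (hpow.const_mul_atTop hL)
end

section
/- Let M ≥ 2 be an integer, and for α > 0 with α ≠ 1 set β_α = (log M)^{1-α}. Then for every probability vector p = (p_1,…,p_M) with 0 < p_i < 1 for all i, the Behavioral entropy satisfies lim_{α→0⁺} H^B_{α,β_α}(p) = log M. -/
open MeasureTheory Real Filter Topology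

theorem tendsto_betaCond_zero {M : ℕ} (hM : 2 ≤ M) :
    Tendsto (betaCond M) (𝓝 0) (𝓝 (Real.log M)) := by
  have hlog : Real.log M ≠ 0 := (Real.log_pos (by exact_mod_cast hM)).ne'
  have h : ContinuousAt (fun α : ℝ => (Real.log M) ^ (1 - α)) 0 :=
    continuousAt_const.rpow (by fun_prop) (Or.inl hlog)
  unfold betaCond
  simpa only [ContinuousAt, sub_zero, Real.rpow_one] using h

/-- As `α → 0`, the conditioned Prelec weight of any `p ∈ (0,1)` tends to `1 / M`. -/
theorem tendsto_prelec_betaCond_zero {M : ℕ} (hM : 2 ≤ M) {p : ℝ} (hp : p ∈ Set.Ioo (0 : ℝ) 1) :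
    Tendsto (fun α : ℝ => prelec α (betaCond M α) p) (𝓝 0) (𝓝 (M : ℝ)⁻¹) := by
  have hlog : -Real.log p ≠ 0 := (neg_pos.2 (Real.log_neg hp.1 hp.2)).ne'
  have hpow : Tendsto (fun α : ℝ => (-Real.log p) ^ α) (𝓝 0) (𝓝 1) := by
    simpa using (Real.continuousAt_const_rpow (b := 0) hlog).tendsto
  have hM0 : (0 : ℝ) < M := by exact_mod_cast (by lia : 0 < M)
  have h := ((tendsto_betaCond_zero hM).neg.mul hpow).rexp
  simpa [prelec, hp.1.ne', Real.exp_neg, Real.exp_log hM0] using h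

/-- For a probability vector with all entries in `(0,1)`, the conditioned Behavioral entropy
tends to `log M` as `α → 0⁺`. -/
theorem behEnt_tendsto_zero (M : ℕ) (hM : 2 ≤ M) (p : Fin M → ℝ)
    (hp : ∀ i, p i ∈ Set.Ioo (0 : ℝ) 1) (hsum : ∑ i, p i = 1) :
    Tendsto (fun α : ℝ => behEnt α (betaCond M α) p) (𝓝[>] 0) (𝓝 (Real.log M)) := by
  have hM0 : (M : ℝ) ≠ 0 := by exact_mod_cast (by lia : M ≠ 0)
  have hterm (i : Fin M) := (tendsto_prelec_betaCond_zero hM (hp i)).mul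
    ((tendsto_prelec_betaCond_zero hM (hp i)).log (inv_ne_zero hM0))
  have h := (tendsto_finsetSum Finset.univ fun i _ => hterm i).neg
  refine Tendsto.mono_left ?_ nhdsWithin_le_nhds
  simpa [behEnt, hM0] using h
end

section
/- Let M ≥ 2 be an integer, and for α > 0 with α ≠ 1 set β_α = (log M)^{1-α}. Then for every probability vector p = (p_1,…,p_M) with p_i ≠ 1/M for all i, the Behavioral entropy satisfies lim_{α→∞} H^B_{α,β_α}(p) = 0. -/
open MeasureTheory Real Filter Topology

lemma betaCond_mul_rpow {M : ℕ} (hM : 2 ≤ M) {x : ℝ} (hx : 0 ≤ x) (α : ℝ) :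
    betaCond M α * x ^ α = Real.log M * (x / Real.log M) ^ α := by
  have hL : 0 < Real.log M := Real.log_pos (by exact_mod_cast hM)
  rw [betaCond, Real.rpow_sub hL, Real.rpow_one, Real.div_rpow hx hL.le]
  ring

lemma tendsto_mul_rpow_mul_exp_neg {c b : ℝ} (hc : 0 < c) (hb : 0 ≤ b) (hb1 : b ≠ 1) :
    Tendsto (fun α : ℝ => c * b ^ α * Real.exp (-(c * b ^ α))) atTop (𝓝 0) := by
  rcases lt_or_gt_of_ne hb1 with h | h
  · have ht : Tendsto (fun α : ℝ => c * b ^ α) atTop (𝓝 0) := by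
      simpa using (tendsto_rpow_atTop_of_base_lt_one b (by linarith) h).const_mul c
    simpa using ht.mul ht.neg.rexp
  · have ht : Tendsto (fun α : ℝ => c * b ^ α) atTop atTop :=
      (tendsto_rpow_atTop_of_base_gt_one b h).const_mul_atTop hc
    simpa [Function.comp_def] using (Real.tendsto_pow_mul_exp_neg_atTop_nhds_zero 1).comp ht

lemma tendsto_prelec_mul_log_prelec {M : ℕ} (hM : 2 ≤ M) {q : ℝ} (hq : 0 ≤ q) (hq1 : q ≤ 1)
    (hne : q ≠ 1 / M) :
    Tendsto (fun α : ℝ => prelec α (betaCond M α) q * Real.log (prelec α (betaCond M α) q))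
      atTop (𝓝 0) := by
  rcases hq.eq_or_lt with rfl | hq0
  · simp [prelec]
  have hM0 : (0 : ℝ) < M := by positivity
  have hL : 0 < Real.log M := Real.log_pos (by exact_mod_cast hM)
  have hx : 0 ≤ -Real.log q := neg_nonneg.2 (Real.log_nonpos hq hq1)
  have hx1 : -Real.log q / Real.log M ≠ 1 := by
    rw [Ne, div_eq_one_iff_eq hL.ne', ← Real.log_inv]
    intro h
    apply hne
    rw [one_div, ← Real.log_injOn_pos (inv_pos.2 hq0) hM0 h, inv_inv]
  have key := (tendsto_mul_rpow_mul_exp_neg hL (div_nonneg hx hL.le) hx1).neg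
  rw [neg_zero] at key
  refine key.congr fun α => ?_
  rw [prelec, if_neg hq0.ne', Real.log_exp, neg_mul, betaCond_mul_rpow hM hx]
  ring

/-- For a probability vector with no entry equal to `1/M`, the conditioned Behavioral entropy
tends to `0` as `α → ∞`. -/
theorem behEnt_tendsto_atTop (M : ℕ) (hM : 2 ≤ M) (p : Fin M → ℝ)
    (hp : ∀ i, 0 ≤ p i) (hsum : ∑ i, p i = 1) (hne : ∀ i, p i ≠ 1 / M) :
    Tendsto (fun α : ℝ => behEnt α (betaCond M α) p) atTop (𝓝 0) := by
  have hle (i : Fin M) : p i ≤ 1 :=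
    hsum ▸ Finset.single_le_sum (fun j _ => hp j) (Finset.mem_univ i)
  simpa [behEnt] using (tendsto_finsetSum Finset.univ fun i _ =>
    tendsto_prelec_mul_log_prelec hM (hp i) (hle i) (hne i)).neg
end

section
/- Let M ≥ 2 be an integer, and for α > 0 with α ≠ 1 set β_α = (log M)^{1-α}. Then the sensitivity of the conditioned Behavioral entropy satisfies lim_{α→0⁺} S(H^B_{α,β_α}) = log M/(M-1)! and lim_{α→∞} S(H^B_{α,β_α}) = 0. -/
open MeasureTheory Real Filter Topology

/-- The simplex `Δ_n = {x ∈ ℝⁿ : xᵢ ≥ 0, ∑ xᵢ ≤ 1}` parametrizing the probability simplex. -/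
def simplexDomain (n : ℕ) : Set (Fin n → ℝ) := {x | (∀ i, 0 ≤ x i) ∧ ∑ i, x i ≤ 1}

/-- Parametrization of the probability simplex `P_M` by `Δ_{M-1}`:
`p = (x_1, …, x_{M-1}, 1 - ∑ x_i)`. -/
noncomputable def simplexParam (M : ℕ) (x : Fin (M - 1) → ℝ) : Fin M → ℝ :=
  fun i => if h : (i : ℕ) < M - 1 then x ⟨(i : ℕ), h⟩ else 1 - ∑ j, x j

/-- The sensitivity `S(H)` of `H : P_M → ℝ`: the Lebesgue integral of `H` over the
parametrized probability simplex. -/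
noncomputable def sens (M : ℕ) (H : (Fin M → ℝ) → ℝ) : ℝ :=
  ∫ x in simplexDomain (M - 1), H (simplexParam M x)

/-- The scaled simplex `{x : xᵢ ≥ 0, ∑ xᵢ ≤ r}` in `ℝⁿ` has volume `rⁿ / n!`. -/
theorem volume_scaled_simplex (n : ℕ) (r : ℝ) (hr : 0 ≤ r) :
    volume {x : Fin n → ℝ | (∀ i, 0 ≤ x i) ∧ ∑ i, x i ≤ r} =
      ENNReal.ofReal (r ^ n / n.factorial) := by
  induction n generalizing r with
  | zero => simp [hr, volume_pi]
  | succ n ih =>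
    have hmeas : MeasurableSet
        {z : ℝ × (Fin n → ℝ) | 0 ≤ z.1 ∧ (∀ i, 0 ≤ z.2 i) ∧ z.1 + ∑ i, z.2 i ≤ r} := by
      apply IsClosed.measurableSet
      simp only [Set.ofPred_and, Set.ofPred_forall]
      refine (isClosed_le (by fun_prop) (by fun_prop)).inter
        ((isClosed_iInter fun i => isClosed_le (by fun_prop) (by fun_prop)).inter
          (isClosed_le (by fun_prop) (by fun_prop)))
    have hpre : {x : Fin (n + 1) → ℝ | (∀ i, 0 ≤ x i) ∧ ∑ i, x i ≤ r} =
        MeasurableEquiv.piFinSuccAbove (fun _ => ℝ) 0 ⁻¹'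
          {z : ℝ × (Fin n → ℝ) | 0 ≤ z.1 ∧ (∀ i, 0 ≤ z.2 i) ∧ z.1 + ∑ i, z.2 i ≤ r} := by
      ext x
      simp [MeasurableEquiv.piFinSuccAbove, Fin.forall_fin_succ, Fin.sum_univ_succ, Fin.tail,
        and_assoc]
    rw [hpre, (volume_preserving_piFinSuccAbove (fun _ : Fin (n + 1) => ℝ) 0).measure_preimage
      hmeas.nullMeasurableSet, Measure.volume_eq_prod, Measure.prod_apply hmeas]
    have hslice : ∀ t : ℝ, volume (Prod.mk t ⁻¹'
        {z : ℝ × (Fin n → ℝ) | 0 ≤ z.1 ∧ (∀ i, 0 ≤ z.2 i) ∧ z.1 + ∑ i, z.2 i ≤ r}) =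
        (Set.Icc 0 r).indicator
          (fun t => ENNReal.ofReal ((r - t) ^ n / n.factorial)) t := by
      intro t
      by_cases ht : t ∈ Set.Icc 0 r
      · rw [Set.indicator_of_mem ht, ← ih (r - t) (by linarith [ht.2])]
        congr 1
        ext y
        simp [ht.1, le_sub_iff_add_le']
      · rw [Set.indicator_of_notMem ht]
        convert! measure_empty (μ := volume)
        ext y
        simp only [Set.mem_preimage, Set.mem_ofPred_eq, Set.mem_empty_iff_false, iff_false]
        rintro ⟨h0, hy, hs⟩
        exact ht ⟨h0, by linarith [Finset.sum_nonneg fun i (_ : i ∈ Finset.univ) => hy i]⟩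
    simp_rw [hslice]
    rw [lintegral_indicator measurableSet_Icc, ← ofReal_integral_eq_lintegral_ofReal]
    · congr 1
      rw [integral_Icc_eq_integral_Ioc, ← intervalIntegral.integral_of_le hr,
        intervalIntegral.integral_comp_sub_left (fun t => t ^ n / (n.factorial : ℝ)) r]
      simp only [sub_self, sub_zero, intervalIntegral.integral_div, integral_pow]
      rw [Nat.factorial_succ]
      push_cast
      field_simp
      simp
    · exact (by fun_prop : Continuous fun t : ℝ => (r - t) ^ n / (n.factorial : ℝ)).integrableOn_Icc
    · filter_upwards [ae_restrict_mem measurableSet_Icc] with t ht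
      have := sub_nonneg.2 ht.2
      positivity

theorem measurableSet_simplexDomain (n : ℕ) : MeasurableSet (simplexDomain n) := by
  apply IsClosed.measurableSet
  simp only [simplexDomain, Set.ofPred_and, Set.ofPred_forall]
  exact (isClosed_iInter fun i => isClosed_le (by fun_prop) (by fun_prop)).inter
    (isClosed_le (by fun_prop) (by fun_prop))

theorem volume_simplexDomain (n : ℕ) :
    volume (simplexDomain n) = ENNReal.ofReal (1 / n.factorial) := by
  simpa [simplexDomain] using volume_scaled_simplex n 1 zero_le_one

theorem measurable_simplexParam (M : ℕ) : Measurable (simplexParam M) := by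
  refine measurable_pi_lambda _ fun i => ?_
  unfold simplexParam
  split_ifs <;> fun_prop

theorem simplexParam_mem_Icc {M : ℕ} {x : Fin (M - 1) → ℝ} (hx : x ∈ simplexDomain (M - 1))
    (i : Fin M) : simplexParam M x i ∈ Set.Icc (0 : ℝ) 1 := by
  obtain ⟨h0, h1⟩ := hx
  unfold simplexParam
  split_ifs with h
  · exact ⟨h0 _, (Finset.single_le_sum (fun j _ => h0 j) (Finset.mem_univ _)).trans h1⟩
  · have := Finset.sum_nonneg fun j (_ : j ∈ Finset.univ) => h0 j
    exact ⟨by linarith, by linarith⟩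

theorem LinearMap.ae_ne_of_ne_zero {n : ℕ} (f : (Fin n → ℝ) →ₗ[ℝ] ℝ) (hf : f ≠ 0) (c : ℝ) :
    ∀ᵐ x, f x ≠ c := by
  obtain ⟨k, -, hk⟩ := f.exists_map_addHaar_eq_smul_addHaar volume volume (f.surjective hf)
  have h : volume.map f {c} = 0 := by simp [hk]
  rw [Measure.map_apply f.continuous_of_finiteDimensional.measurable
    (measurableSet_singleton c)] at h
  exact measure_eq_zero_iff_ae_notMem.1 h

theorem ae_simplexParam_ne {M : ℕ} (hM : 2 ≤ M) (i : Fin M) (c : ℝ) :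
    ∀ᵐ x, simplexParam M x i ≠ c := by
  unfold simplexParam
  split_ifs with h
  · refine LinearMap.ae_ne_of_ne_zero (LinearMap.proj ⟨(i : ℕ), h⟩) (fun h0 => ?_) c
    simpa using LinearMap.congr_fun h0 1
  · have hne : (∑ j, LinearMap.proj j : (Fin (M - 1) → ℝ) →ₗ[ℝ] ℝ) ≠ 0 := fun h0 => by
      have := LinearMap.congr_fun h0 1
      simp at this
      omega
    filter_upwards [LinearMap.ae_ne_of_ne_zero _ hne (1 - c)] with x hx hc
    apply hx
    simp only [LinearMap.sum_apply, LinearMap.proj_apply]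
    linarith

theorem measurable_prelec (α β : ℝ) : Measurable (prelec α β) :=
  Measurable.ite (measurableSet_singleton 0) measurable_const (by fun_prop)

theorem prelec_mul_log_prelec {α β p : ℝ} (hp : p ≠ 0) :
    -(prelec α β p * Real.log (prelec α β p)) =
      β * (-Real.log p) ^ α * Real.exp (-(β * (-Real.log p) ^ α)) := by
  simp only [prelec, if_neg hp, Real.log_exp]
  ring_nf

theorem abs_prelec_mul_log_prelec_le {α β p : ℝ} (hβ : 0 ≤ β) (hp : p ∈ Set.Icc (0 : ℝ) 1) :
    |prelec α β p * Real.log (prelec α β p)| ≤ 1 := by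
  by_cases h : p = 0
  · simp [prelec, h]
  · have hu : 0 ≤ β * (-Real.log p) ^ α :=
      mul_nonneg hβ (rpow_nonneg (neg_nonneg.2 (Real.log_nonpos hp.1 hp.2)) _)
    rw [← abs_neg, prelec_mul_log_prelec h, abs_of_nonneg (by positivity), Real.exp_neg,
      ← div_eq_mul_inv, div_le_one (Real.exp_pos _)]
    linarith [Real.add_one_le_exp (β * (-Real.log p) ^ α)]

theorem measurable_behEnt (M : ℕ) (α β : ℝ) :
    Measurable (behEnt α β : (Fin M → ℝ) → ℝ) := by
  have := measurable_prelec α β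
  unfold behEnt
  fun_prop

theorem abs_behEnt_le {M : ℕ} {α β : ℝ} (hβ : 0 ≤ β) {p : Fin M → ℝ}
    (hp : ∀ i, p i ∈ Set.Icc (0 : ℝ) 1) : |behEnt α β p| ≤ M := by
  rw [behEnt, abs_neg]
  refine (Finset.abs_sum_le_sum_abs _ _).trans ?_
  simpa using Finset.sum_le_sum fun i (_ : i ∈ Finset.univ) =>
    abs_prelec_mul_log_prelec_le (α := α) hβ (hp i)

theorem tendsto_sens_behEnt {M : ℕ} (hM : 2 ≤ M) {F : Filter ℝ} [F.IsCountablyGenerated]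
    {β : ℝ → ℝ} (hβ : ∀ α, 0 ≤ β α) (c a : ℝ)
    (h : ∀ p : ℝ, 0 < p → p < 1 → p ≠ a →
      Tendsto (fun α => β α * (-Real.log p) ^ α * Real.exp (-(β α * (-Real.log p) ^ α))) F (𝓝 c)) :
    Tendsto (fun α => sens M (behEnt α (β α))) F (𝓝 (M * c / (M - 1).factorial)) := by
  have hlim : (M * c / (M - 1).factorial : ℝ) =
      ∫ _ in simplexDomain (M - 1), (M * c : ℝ) := by
    rw [setIntegral_const, Measure.real, volume_simplexDomain,
      ENNReal.toReal_ofReal (by positivity), smul_eq_mul]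
    ring
  rw [hlim]
  have : IsFiniteMeasure (volume.restrict (simplexDomain (M - 1))) :=
    isFiniteMeasure_restrict.2 (by simp [volume_simplexDomain])
  refine tendsto_integral_filter_of_dominated_convergence (fun _ => (M : ℝ))
    (Eventually.of_forall fun α =>
      ((measurable_behEnt M α _).comp (measurable_simplexParam M)).aestronglyMeasurable)
    (Eventually.of_forall fun α => ?_) (integrable_const _) ?_
  · filter_upwards [ae_restrict_mem (measurableSet_simplexDomain _)] with x hx
    exact abs_behEnt_le (hβ α) (simplexParam_mem_Icc hx)
  · have hne (b : ℝ) : ∀ᵐ x, ∀ i, simplexParam M x i ≠ b :=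
      ae_all_iff.2 fun i => ae_simplexParam_ne hM i b
    filter_upwards [ae_restrict_mem (measurableSet_simplexDomain _), ae_restrict_of_ae (hne 0),
      ae_restrict_of_ae (hne 1), ae_restrict_of_ae (hne a)] with x hx h0 h1 ha
    have hsum := tendsto_finsetSum Finset.univ fun i _ =>
      h _ ((simplexParam_mem_Icc hx i).1.lt_of_ne' (h0 i))
        ((simplexParam_mem_Icc hx i).2.lt_of_ne (h1 i)) (ha i)
    simp only [Finset.sum_const, Finset.card_univ, Fintype.card_fin, nsmul_eq_mul] at hsum
    refine hsum.congr fun α => ?_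
    rw [behEnt, ← Finset.sum_neg_distrib]
    exact Finset.sum_congr rfl fun i _ => (prelec_mul_log_prelec (h0 i)).symm

theorem tendsto_mul_exp_neg_atTop : Tendsto (fun u : ℝ => u * Real.exp (-u)) atTop (𝓝 0) := by
  simpa using tendsto_pow_mul_exp_neg_atTop_nhds_zero 1

/-- Limits of the sensitivity of the conditioned Behavioral entropy:
`log M/(M-1)!` as `α → 0⁺` and `0` as `α → ∞`. -/
theorem sens_behEnt_limits (M : ℕ) (hM : 2 ≤ M) :
    Tendsto (fun α : ℝ => sens M (behEnt α (betaCond M α))) (𝓝[>] 0)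
      (𝓝 (Real.log M / (M - 1).factorial)) ∧
    Tendsto (fun α : ℝ => sens M (behEnt α (betaCond M α))) atTop (𝓝 0) := by
  have hM0 : (0 : ℝ) < M := by positivity
  have hL : 0 < Real.log M := Real.log_pos (by exact_mod_cast hM)
  have hβ (α : ℝ) : 0 ≤ betaCond M α := rpow_nonneg hL.le _
  have hcont : Continuous fun u : ℝ => u * Real.exp (-u) := by fun_prop
  constructor
  · have hc : Real.log M = M * (Real.log M * Real.exp (-Real.log M)) := by
      rw [Real.exp_neg, Real.exp_log hM0]
      field_simp
    rw [hc]
    refine tendsto_sens_behEnt hM hβ _ 0 fun p hp0 hp1 _ => (hcont.tendsto _).comp ?_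
    have hl : -Real.log p ≠ 0 := (neg_pos.2 (Real.log_neg hp0 hp1)).ne'
    have hu : ContinuousAt (fun α : ℝ => betaCond M α * (-Real.log p) ^ α) 0 :=
      (continuousAt_const.rpow (by fun_prop) (Or.inl hL.ne')).mul
        (Real.continuousAt_const_rpow hl)
    simpa [betaCond] using hu.tendsto.mono_left nhdsWithin_le_nhds
  · have key := tendsto_sens_behEnt (F := atTop) hM hβ 0 (1 / M) fun p hp0 hp1 hpM => by
      have hl : 0 < -Real.log p := neg_pos.2 (Real.log_neg hp0 hp1)
      have hu (α : ℝ) : Real.log M * (-Real.log p / Real.log M) ^ α =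
          betaCond M α * (-Real.log p) ^ α := by
        rw [betaCond, rpow_sub hL, rpow_one, div_rpow hl.le hL.le]
        ring
      simp_rw [← hu]
      have hne : -Real.log p ≠ Real.log M := fun he => hpM <| by
        rw [← Real.exp_log hp0, ← neg_neg (Real.log p), he, Real.exp_neg, Real.exp_log hM0, one_div]
      rcases hne.lt_or_gt with hlt | hgt
      · have := (tendsto_rpow_atTop_of_base_lt_one (-Real.log p / Real.log M)
          (by linarith [div_pos hl hL]) ((div_lt_one hL).2 hlt)).const_mul (Real.log M)
        simpa [Function.comp_def] using (hcont.tendsto _).comp this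
      · exact tendsto_mul_exp_neg_atTop.comp
          ((tendsto_rpow_atTop_of_base_gt_one _ ((one_lt_div hL).2 hgt)).const_mul_atTop hL)
    simpa using key
end

section
/- Let M ≥ 2 be an integer. Then the sensitivity of the Renyi entropy satisfies lim_{γ→0⁺} S(H^R_γ) = log M/(M-1)! and lim_{γ→∞} S(H^R_γ) = ∫_{Δ_{M-1}} -log( max(x_1,…,x_{M-1}, 1-Σ_{i=1}^{M-1} x_i) ) dx. -/
open MeasureTheory Real Filter Topology

/-- Renyi entropy `H^R_γ(p) = (1/(1-γ)) log (∑ i, p_i^γ)`. -/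
noncomputable def renyiEnt (γ : ℝ) {M : ℕ} (p : Fin M → ℝ) : ℝ :=
  (1 / (1 - γ)) * Real.log (∑ i, p i ^ γ)

/-- Min-entropy `-log (max_i p_i)`. -/
noncomputable def minEnt {M : ℕ} (p : Fin M → ℝ) : ℝ := -Real.log (⨆ i, p i)

theorem measurableSet_simplex (n : ℕ) (t : ℝ) :
    MeasurableSet {x : Fin n → ℝ | (∀ i, 0 ≤ x i) ∧ ∑ i, x i ≤ t} := by
  apply MeasurableSet.inter
  · exact measurableSet_Ici (a := (0 : Fin n → ℝ))
  · exact measurableSet_le (f := fun x : Fin n → ℝ => ∑ i, x i) (g := fun _ => t)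
      (by fun_prop) measurable_const

theorem volume_simplex (n : ℕ) (t : ℝ) (ht : 0 ≤ t) :
    volume {x : Fin n → ℝ | (∀ i, 0 ≤ x i) ∧ ∑ i, x i ≤ t} =
      ENNReal.ofReal (t ^ n / n.factorial) := by
  induction n generalizing t with
  | zero => simp [ht, volume_pi]
  | succ n ih =>
    let S : Set (ℝ × (Fin n → ℝ)) :=
      {z | 0 ≤ z.1 ∧ z.2 ∈ {y : Fin n → ℝ | (∀ i, 0 ≤ y i) ∧ ∑ i, y i ≤ t - z.1}}
    have hS : MeasurableSet S := by
      have h0 : Measurable fun z : ℝ × (Fin n → ℝ) => z.1 := measurable_fst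
      have h1 : Measurable fun z : ℝ × (Fin n → ℝ) => ∑ i, z.2 i := by fun_prop
      exact (measurableSet_le measurable_const h0).inter
        ((measurable_snd (measurableSet_Ici (a := (0 : Fin n → ℝ)))).inter
          (measurableSet_le h1 (h0.const_sub t)))
    have hpre : {x : Fin (n + 1) → ℝ | (∀ i, 0 ≤ x i) ∧ ∑ i, x i ≤ t} =
        (MeasurableEquiv.piFinSuccAbove (fun _ => ℝ) 0) ⁻¹' S := by
      ext x
      simp [S, Fin.forall_fin_succ, Fin.sum_univ_succ, MeasurableEquiv.piFinSuccAbove,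
        Fin.insertNthEquiv, Fin.tail, and_assoc, le_sub_iff_add_le']
    rw [hpre, (volume_preserving_piFinSuccAbove (fun _ => ℝ) 0).measure_preimage
      hS.nullMeasurableSet, Measure.volume_eq_prod, Measure.prod_apply hS]
    have hslice : ∀ a : ℝ, volume (Prod.mk a ⁻¹' S) =
        (Set.Icc 0 t).indicator (fun a => ENNReal.ofReal ((t - a) ^ n / n.factorial)) a := by
      intro a
      by_cases ha : a ∈ Set.Icc 0 t
      · rw [Set.indicator_of_mem ha, ← ih (t - a) (by linarith [ha.2])]
        congr 1
        ext y
        simp [S, ha.1]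
      · rw [Set.indicator_of_notMem ha]
        convert measure_empty (μ := (volume : Measure (Fin n → ℝ)))
        ext y
        simp only [S, Set.mem_preimage, Set.mem_ofPred_eq, Set.mem_empty_iff_false, iff_false]
        rintro ⟨h0, hy, hs⟩
        exact ha ⟨h0, by linarith [Finset.sum_nonneg fun i (_ : i ∈ Finset.univ) => hy i]⟩
    simp_rw [hslice]
    rw [lintegral_indicator measurableSet_Icc, ← ofReal_integral_eq_lintegral_ofReal]
    · congr 1
      rw [integral_Icc_eq_integral_Ioc, ← intervalIntegral.integral_of_le ht,
        intervalIntegral.integral_div, intervalIntegral.integral_comp_sub_left (fun x => x ^ n) t,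
        integral_pow]
      simp [Nat.factorial_succ]
      field_simp
    · exact (Continuous.continuousOn (by fun_prop)).integrableOn_compact isCompact_Icc
    · refine (ae_restrict_iff' measurableSet_Icc).2 (ae_of_all _ fun a ha => ?_)
      have : 0 ≤ t - a := by linarith [ha.2]
      simp only [Pi.zero_apply]
      positivity

theorem measurable_renyiEnt (γ : ℝ) (M : ℕ) :
    Measurable (renyiEnt γ : (Fin M → ℝ) → ℝ) := by
  unfold renyiEnt
  fun_prop

theorem simplexParam_nonneg {M : ℕ} {x : Fin (M - 1) → ℝ} (hx : x ∈ simplexDomain (M - 1))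
    (i : Fin M) : 0 ≤ simplexParam M x i := by
  unfold simplexParam
  split_ifs
  · exact hx.1 _
  · linarith [hx.2]

theorem sum_simplexParam {M : ℕ} (hM : M ≠ 0) (x : Fin (M - 1) → ℝ) :
    ∑ i, simplexParam M x i = 1 := by
  obtain ⟨n, rfl⟩ := Nat.exists_eq_succ_of_ne_zero hM
  rw [Fin.sum_univ_castSucc]
  simp [simplexParam]

theorem ae_simplexParam_ne_zero (M : ℕ) : ∀ᵐ x, ∀ i, simplexParam M x i ≠ 0 := by
  have hsum : ∀ᵐ x : Fin (M - 1) → ℝ, ∑ j, x j ≠ 1 := by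
    let s : AffineSubspace ℝ (Fin (M - 1) → ℝ) :=
      { carrier := {x | ∑ j, x j = 1}
        smul_vsub_vadd_mem' := by
          intro c p q r hp hq hr
          simp_all [Finset.sum_add_distrib, ← Finset.mul_sum] }
    have hs : s ≠ ⊤ := by
      intro h
      have h0 : (0 : Fin (M - 1) → ℝ) ∈ s := h ▸ AffineSubspace.mem_top ..
      have : ∑ j : Fin (M - 1), (0 : Fin (M - 1) → ℝ) j = 1 := h0
      simp at this
    have := Measure.addHaar_affineSubspace volume s hs
    simp only [ae_iff, not_not]
    exact this
  refine ae_all_iff.2 fun i => ?_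
  by_cases h : (i : ℕ) < M - 1
  · simpa only [simplexParam, h, dite_true, volume_pi] using
      Measure.ae_eval_ne (μ := fun _ : Fin (M - 1) => (volume : Measure ℝ)) ⟨(i : ℕ), h⟩ 0
  · filter_upwards [hsum] with x hx
    simpa only [simplexParam, h, dite_false, sub_ne_zero] using hx.symm

section ProbabilityVector

variable {M : ℕ} {p : Fin M → ℝ}

theorem apply_le_one (hp : ∀ i, 0 ≤ p i) (hs : ∑ i, p i = 1) (i : Fin M) : p i ≤ 1 :=
  hs ▸ Finset.single_le_sum (fun j _ => hp j) (Finset.mem_univ i)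

theorem abs_renyiEnt_le_of_le_half (hp : ∀ i, 0 ≤ p i) (hs : ∑ i, p i = 1) {γ : ℝ} (h0 : 0 < γ)
    (h1 : γ ≤ 1 / 2) : |renyiEnt γ p| ≤ 2 * Real.log M := by
  have hle : ∑ i, p i ^ γ ≤ M := by
    calc _ ≤ ∑ i : Fin M, (1 : ℝ) :=
          Finset.sum_le_sum fun i _ => rpow_le_one (hp i) (apply_le_one hp hs i) h0.le
      _ = M := by simp
  have hge : 1 ≤ ∑ i, p i ^ γ := by
    rw [← hs]
    exact Finset.sum_le_sum fun i _ =>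
      self_le_rpow_of_le_one (hp i) (apply_le_one hp hs i) (by linarith)
  have hL0 := Real.log_nonneg hge
  have hL := Real.log_le_log (by linarith) hle
  have hγ : 0 < 1 - γ := by linarith
  have hinv : 1 / (1 - γ) ≤ 2 := by
    rw [div_le_iff₀ hγ]
    linarith
  rw [renyiEnt, abs_of_nonneg (by positivity)]
  gcongr

theorem tendsto_renyiEnt_zero (hp : ∀ i, p i ≠ 0) :
    Tendsto (fun γ => renyiEnt γ p) (𝓝 0) (𝓝 (Real.log M)) := by
  rcases Nat.eq_zero_or_pos M with rfl | hM
  · simp [renyiEnt]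
  have hsum : Tendsto (fun γ : ℝ => ∑ i, p i ^ γ) (𝓝 0) (𝓝 (M : ℝ)) := by
    have : Tendsto (fun γ : ℝ => ∑ i, p i ^ γ) (𝓝 0) (𝓝 (∑ i, p i ^ (0 : ℝ))) :=
      tendsto_finsetSum _ fun i _ => (continuousAt_const_rpow (hp i)).tendsto
    simpa using this
  have hc : Tendsto (fun γ : ℝ => 1 / (1 - γ)) (𝓝 0) (𝓝 (1 / (1 - 0))) :=
    ContinuousAt.tendsto (by fun_prop (disch := norm_num))
  simpa [renyiEnt] using hc.mul (hsum.log (by positivity))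

theorem abs_minEnt_le (hp : ∀ i, 0 ≤ p i) (hs : ∑ i, p i = 1) : |minEnt p| ≤ Real.log M := by
  rcases Nat.eq_zero_or_pos M with rfl | hM
  · simp at hs
  have : Nonempty (Fin M) := ⟨⟨0, hM⟩⟩
  have hM' : (0 : ℝ) < M := by exact_mod_cast hM
  have hle : (⨆ i, p i) ≤ 1 := ciSup_le (apply_le_one hp hs)
  have hge : (M : ℝ)⁻¹ ≤ ⨆ i, p i := by
    have : ∑ i, p i ≤ ∑ _i : Fin M, ⨆ i, p i :=
      Finset.sum_le_sum fun i _ => le_ciSup (Set.finite_range p).bddAbove i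
    rw [hs] at this
    rw [inv_le_iff_one_le_mul₀' hM']
    simpa using this
  have hlog := Real.log_le_log (by positivity) hge
  rw [Real.log_inv] at hlog
  have hlog' := Real.log_nonpos ((by positivity : (0 : ℝ) ≤ (M : ℝ)⁻¹).trans hge) hle
  rw [minEnt, abs_of_nonneg (by linarith)]
  linarith

theorem abs_renyiEnt_sub_minEnt_le (hp : ∀ i, 0 ≤ p i) (hs : ∑ i, p i = 1) {γ : ℝ}
    (hγ : 1 < γ) : |renyiEnt γ p - minEnt p| ≤ Real.log M / (γ - 1) := by
  rcases Nat.eq_zero_or_pos M with rfl | hM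
  · simp at hs
  have : Nonempty (Fin M) := ⟨⟨0, hM⟩⟩
  obtain ⟨k, hk⟩ := exists_eq_ciSup_of_finite (f := p)
  have hle : ∀ i, p i ≤ p k := fun i => hk ▸ le_ciSup (Set.finite_range p).bddAbove i
  have hkpos : 0 < p k := by
    refine (hp k).lt_of_ne fun h => ?_
    have : ∑ i, p i = 0 := Finset.sum_eq_zero fun i _ => le_antisymm (h ▸ hle i) (hp i)
    linarith
  have hbound := abs_minEnt_le hp hs
  have hnonpos := Real.log_nonpos hkpos.le (apply_le_one hp hs k)
  have hlow : p k ^ γ ≤ ∑ i, p i ^ γ :=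
    Finset.single_le_sum (f := fun i => p i ^ γ) (fun i _ => rpow_nonneg (hp i) γ)
      (Finset.mem_univ k)
  have hup : ∑ i, p i ^ γ ≤ M * p k ^ γ := by
    calc _ ≤ ∑ _i : Fin M, p k ^ γ :=
          Finset.sum_le_sum fun i _ => rpow_le_rpow (hp i) (hle i) (by linarith)
      _ = _ := by simp
  have hpow : 0 < p k ^ γ := rpow_pos_of_pos hkpos γ
  have hlow' := Real.log_le_log hpow hlow
  have hup' := Real.log_le_log (hpow.trans_le hlow) hup
  rw [Real.log_mul (by positivity) hpow.ne', Real.log_rpow hkpos] at hup'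
  rw [Real.log_rpow hkpos] at hlow'
  rw [minEnt, ← hk, abs_neg, abs_of_nonpos hnonpos] at hbound
  have hγ' : 0 < γ - 1 := by linarith
  have hne : 1 - γ ≠ 0 := by linarith
  have heq : renyiEnt γ p - minEnt p =
      -((Real.log (∑ i, p i ^ γ) - γ * Real.log (p k)) + Real.log (p k)) / (γ - 1) := by
    rw [renyiEnt, minEnt, ← hk]
    field_simp
    ring
  rw [heq, abs_div, abs_of_pos hγ', abs_neg]
  gcongr
  rw [abs_le]
  constructor <;> linarith

theorem tendsto_renyiEnt_atTop (hp : ∀ i, 0 ≤ p i) (hs : ∑ i, p i = 1) :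
    Tendsto (fun γ => renyiEnt γ p) atTop (𝓝 (minEnt p)) := by
  rw [tendsto_iff_norm_sub_tendsto_zero]
  have hlim : Tendsto (fun γ : ℝ => Real.log M / (γ - 1)) atTop (𝓝 0) :=
    (tendsto_atTop_add_const_right _ (-1) tendsto_id).const_div_atTop _
  refine squeeze_zero' (Eventually.of_forall fun _ => norm_nonneg _) ?_ hlim
  filter_upwards [eventually_gt_atTop 1] with γ hγ
  exact abs_renyiEnt_sub_minEnt_le hp hs hγ

theorem abs_renyiEnt_le_of_two_le (hp : ∀ i, 0 ≤ p i) (hs : ∑ i, p i = 1) {γ : ℝ}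
    (hγ : 2 ≤ γ) : |renyiEnt γ p| ≤ 2 * Real.log M := by
  have hM := abs_minEnt_le hp hs
  have h := abs_renyiEnt_sub_minEnt_le hp hs (by linarith : 1 < γ)
  have hd : Real.log M / (γ - 1) ≤ Real.log M :=
    div_le_self ((abs_nonneg _).trans hM) (by linarith)
  linarith [abs_sub_abs_le_abs_sub (renyiEnt γ p) (minEnt p)]

end ProbabilityVector

theorem tendsto_sens {M : ℕ} {l : Filter ℝ} [l.IsCountablyGenerated] {f : (Fin M → ℝ) → ℝ}
    {C : ℝ}
    (hbound : ∀ᶠ γ in l, ∀ x ∈ simplexDomain (M - 1), |renyiEnt γ (simplexParam M x)| ≤ C)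
    (hlim : ∀ᵐ x, x ∈ simplexDomain (M - 1) →
      Tendsto (fun γ => renyiEnt γ (simplexParam M x)) l (𝓝 (f (simplexParam M x)))) :
    Tendsto (fun γ => sens M (renyiEnt γ)) l (𝓝 (sens M f)) := by
  have hD : MeasurableSet (simplexDomain (M - 1)) := measurableSet_simplex _ 1
  have hvol : volume (simplexDomain (M - 1)) ≠ ⊤ :=
    (volume_simplex (M - 1) 1 zero_le_one).trans_ne ENNReal.ofReal_ne_top
  refine tendsto_integral_filter_of_dominated_convergence (fun _ => C) ?_ ?_ ?_ ?_
  · exact Eventually.of_forall fun γ =>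
      ((measurable_renyiEnt γ M).comp (measurable_simplexParam M)).aestronglyMeasurable
  · filter_upwards [hbound] with γ hγ
    exact (ae_restrict_iff' hD).2 (ae_of_all _ hγ)
  · exact integrableOn_const hvol
  · exact (ae_restrict_iff' hD).2 hlim

theorem sens_const (M : ℕ) (c : ℝ) : sens M (fun _ => c) = c / (M - 1).factorial := by
  have hvol : volume.real (simplexDomain (M - 1)) = 1 / (M - 1).factorial := by
    rw [Measure.real, simplexDomain, volume_simplex _ _ zero_le_one, one_pow,
      ENNReal.toReal_ofReal (by positivity)]
  rw [sens, setIntegral_const, hvol, smul_eq_mul]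
  ring

/-- Limits of the Renyi sensitivity: `log M/(M-1)!` as `γ → 0⁺`, and the integral of the
min-entropy over the simplex as `γ → ∞`. -/
theorem sens_renyi_limits (M : ℕ) (hM : 2 ≤ M) :
    Tendsto (fun γ : ℝ => sens M (renyiEnt γ)) (𝓝[>] 0)
      (𝓝 (Real.log M / (M - 1).factorial)) ∧
    Tendsto (fun γ : ℝ => sens M (renyiEnt γ)) atTop
      (𝓝 (∫ x in simplexDomain (M - 1), minEnt (simplexParam M x))) := by
  have hM0 : M ≠ 0 := by omega
  constructor
  · rw [← sens_const]
    refine tendsto_sens (C := 2 * Real.log M) ?_ ?_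
    · filter_upwards [Ioc_mem_nhdsGT (by norm_num : (0 : ℝ) < 1 / 2)] with γ hγ x hx
      exact abs_renyiEnt_le_of_le_half (simplexParam_nonneg hx) (sum_simplexParam hM0 x) hγ.1 hγ.2
    · filter_upwards [ae_simplexParam_ne_zero M] with x hx _
      exact (tendsto_renyiEnt_zero hx).mono_left nhdsWithin_le_nhds
  · refine tendsto_sens (f := minEnt) (C := 2 * Real.log M) ?_ ?_
    · filter_upwards [eventually_ge_atTop 2] with γ hγ x hx
      exact abs_renyiEnt_le_of_two_le (simplexParam_nonneg hx) (sum_simplexParam hM0 x) hγ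
    · exact ae_of_all _ fun x hx =>
        tendsto_renyiEnt_atTop (simplexParam_nonneg hx) (sum_simplexParam hM0 x)
end
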